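/- For every local good semigroup T ⊆ ℕ², the genus satisfies g(T) = NL(ℕ²∖T). -/

import Mathlib

/-- The ambient space `ℤ²`; `ℕ²` is identified with the nonnegative orthant. -/
abbrev Z2 : Type := ℤ × ℤ

/-- The nonnegative orthant, representing `ℕ² ⊆ ℤ²`. -/
def orth : Set Z2 := {a : Z2 | 0 ≤ a.1 ∧ 0 ≤ a.2}

/-- Property (G1): closure under componentwise minimum. -/
def MinClosed (E : Set Z2) : Prop := ∀ a ∈ E, ∀ b ∈ E, a ⊓ b ∈ E

/-- Property (G3). -/
def G3P (E : Set Z2) : Prop :=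
  ∀ a ∈ E, ∀ b ∈ E, a ≠ b →
    (a.1 = b.1 →
      ∃ e ∈ E, a.1 < e.1 ∧ min a.2 b.2 ≤ e.2 ∧ (a.2 ≠ b.2 → e.2 = min a.2 b.2)) ∧
    (a.2 = b.2 →
      ∃ e ∈ E, a.2 < e.2 ∧ min a.1 b.1 ≤ e.1 ∧ (a.1 ≠ b.1 → e.1 = min a.1 b.1))

/-- A good semigroup of `ℕ²` (viewed inside `ℤ²`). -/
def IsGood (S : Set Z2) : Prop :=
  S ⊆ orth ∧ (0 : Z2) ∈ S ∧ (∀ a ∈ S, ∀ b ∈ S, a + b ∈ S) ∧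
  MinClosed S ∧ (∃ δ : Z2, ∀ y : Z2, δ ≤ y → y ∈ S) ∧ G3P S

/-- A good semigroup is local if its only element with a zero coordinate is `0`. -/
def IsLocal (S : Set Z2) : Prop := ∀ a ∈ S, (a.1 = 0 ∨ a.2 = 0) → a = 0

/-- A relative good ideal of `S`. -/
def IsRelGoodIdeal (S E : Set Z2) : Prop :=
  E.Nonempty ∧ (∀ e ∈ E, ∀ s ∈ S, e + s ∈ E) ∧ (∃ a ∈ S, ∀ e ∈ E, a + e ∈ S) ∧
  MinClosed E ∧ G3P E

/-- A saturated chain of length `n` in `E`. -/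
def IsSatChain (E : Set Z2) (n : ℕ) (f : ℕ → Z2) : Prop :=
  (∀ i ≤ n, f i ∈ E) ∧ (∀ i < n, f i < f (i + 1)) ∧
  (∀ i < n, ∀ c ∈ E, ¬ (f i < c ∧ c < f (i + 1)))

/-- `d_E(a,b)`: the common length of all saturated chains in `E` from `a` to `b`. -/
noncomputable def chainDist (E : Set Z2) (a b : Z2) : ℕ :=
  sSup {n : ℕ | ∃ f : ℕ → Z2, IsSatChain E n f ∧ f 0 = a ∧ f n = b}

/-- The (componentwise) minimal element `e(E)` of `E`. -/
noncomputable def minEl (E : Set Z2) : Z2 :=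
  (sInf (Prod.fst '' E), sInf (Prod.snd '' E))

/-- The distance `d(E∖F)` between `F ⊆ E`: the common value of
`d_E(e(E),α) - d_F(e(F),α)` for all sufficiently large `α ∈ F`. -/
noncomputable def dist2 (E F : Set Z2) : ℤ :=
  sSup {z : ℤ | ∃ β : Z2, ∀ α ∈ F, β ≤ α →
    (chainDist E (minEl E) α : ℤ) - (chainDist F (minEl F) α : ℤ) = z}

/-- The conductor `c(E)`: the componentwise minimal `δ` with `δ + ℕ² ⊆ E`. -/
noncomputable def condE (E : Set Z2) : Z2 :=
  (sInf ((fun δ : Z2 => δ.1) '' {δ : Z2 | ∀ y : Z2, δ ≤ y → y ∈ E}),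
   sInf ((fun δ : Z2 => δ.2) '' {δ : Z2 | ∀ y : Z2, δ ≤ y → y ∈ E}))

/-- The conductor ideal `C(E) = {β ∈ E : β ≥ c(E)}`. -/
noncomputable def CIdeal (E : Set Z2) : Set Z2 := {b ∈ E | condE E ≤ b}

/-- The length `l(E) = d(E ∖ C(E))`. -/
noncomputable def glen (E : Set Z2) : ℤ := dist2 E (CIdeal E)

/-- The genus `g(E) = d(ℕ² ∖ E)`. -/
noncomputable def genus (E : Set Z2) : ℤ := dist2 orth E

/-- The good semigroup `ℕ²(1,1) = {0} ∪ ((1,1) + ℕ²)`. -/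
def N2oneone : Set Z2 := {a : Z2 | a = 0 ∨ ((1 : ℤ), (1 : ℤ)) ≤ a}
/-- `a ≪ b`: both coordinates strictly smaller. -/
def llt (a b : Z2) : Prop := a.1 < b.1 ∧ a.2 < b.2

/-- `B`: the elements of `R` that are maximal with respect to `≤≤`. -/
def Bof (R : Set Z2) : Set Z2 := {a ∈ R | ∀ b ∈ R, ¬ llt a b}

/-- `C`: the elements of `B` expressible as the componentwise minimum of two
other elements of `B`. -/
def Cof (B : Set Z2) : Set Z2 :=
  {a ∈ B | ∃ b ∈ B, ∃ c ∈ B, b ≠ a ∧ c ≠ a ∧ a = b ⊓ c}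

/-- One step of the level construction: `D = B ∖ C`. -/
def Dof (R : Set Z2) : Set Z2 := Bof R \ Cof (Bof R)

/-- `NLrem A i = D^(1) ∪ ⋯ ∪ D^(i)`: the union of the first `i` levels of `A`. -/
def NLrem (A : Set Z2) : ℕ → Set Z2
  | 0 => ∅
  | i + 1 => NLrem A i ∪ Dof (A \ NLrem A i)

/-- `NL(A)`: the number of levels of `A`, i.e. the least `N` with
`A = D^(1) ∪ ⋯ ∪ D^(N)`. -/
noncomputable def NL (A : Set Z2) : ℕ := sInf {N : ℕ | A ⊆ NLrem A N}

/-- The pseudo-Frobenius elements `PF(S) = {α ∈ ℕ²∖S : α + M ⊆ S}`. -/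
def PFset (S : Set Z2) : Set Z2 :=
  {a : Z2 | a ∈ orth ∧ a ∉ S ∧ ∀ m ∈ S, m ≠ 0 → a + m ∈ S}

/-- The type `t(S) = NL(PF(S))`. -/
noncomputable def typ (S : Set Z2) : ℕ := NL (PFset S)

/-- `E` has an element on the vertical ray starting at `a`. -/
def JumpFst (E : Set Z2) (a : Z2) : Prop := ∃ x ∈ E, x.1 = a.1 ∧ a.2 ≤ x.2

/-- `E` has an element on the horizontal ray starting at `a`. -/
def JumpSnd (E : Set Z2) (a : Z2) : Prop := ∃ x ∈ E, x.2 = a.2 ∧ a.1 ≤ x.1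

open Classical in
/-- `1` if the step from `a` to `a + (1, 0)` is not a jump of `E`, and `0` otherwise. -/
noncomputable def gapFst (E : Set Z2) (a : Z2) : ℕ := if JumpFst E a then 0 else 1

open Classical in
/-- `1` if the step from `a` to `a + (0, 1)` is not a jump of `E`, and `0` otherwise. -/
noncomputable def gapSnd (E : Set Z2) (a : Z2) : ℕ := if JumpSnd E a then 0 else 1

theorem mem_of_jumps {E : Set Z2} (h1 : MinClosed E) {a : Z2} (hf : JumpFst E a)
    (hs : JumpSnd E a) : a ∈ E := by
  obtain ⟨x, hx, hx1, hx2⟩ := hf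
  obtain ⟨y, hy, hy2, hy1⟩ := hs
  have h := h1 x hx y hy
  have e : x ⊓ y = a := Prod.ext (by simp; omega) (by simp; omega)
  rwa [e] at h

theorem jumpFst_of_mem {E : Set Z2} {a : Z2} (h : a ∈ E) : JumpFst E a := ⟨a, h, rfl, le_rfl⟩

theorem jumpSnd_of_mem {E : Set Z2} {a : Z2} (h : a ∈ E) : JumpSnd E a := ⟨a, h, rfl, le_rfl⟩

/-- The number of non-jumps is the same along both paths around a unit square. -/
theorem gap_square {E : Set Z2} (h1 : MinClosed E) (h3 : G3P E) (x y : ℤ) :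
    gapFst E (x, y) + gapSnd E (x + 1, y) = gapSnd E (x, y) + gapFst E (x, y + 1) := by
  have hf : JumpFst E (x, y + 1) → JumpFst E (x, y) := by
    rintro ⟨p, hp, hp1, hp2⟩
    exact ⟨p, hp, hp1, by simp at *; omega⟩
  have hs : JumpSnd E (x + 1, y) → JumpSnd E (x, y) := by
    rintro ⟨p, hp, hp1, hp2⟩
    exact ⟨p, hp, hp1, by simp at *; omega⟩
  have hf' : JumpFst E (x, y) → JumpFst E (x, y + 1) ∨ (x, y) ∈ E := by
    rintro ⟨p, hp, hp1, hp2⟩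
    rcases hp2.lt_or_eq with h | h
    · exact Or.inl ⟨p, hp, hp1, by simp at *; omega⟩
    · exact Or.inr (by rwa [show (x, y) = p from Prod.ext hp1.symm h])
  have hs' : JumpSnd E (x, y) → JumpSnd E (x + 1, y) ∨ (x, y) ∈ E := by
    rintro ⟨p, hp, hp1, hp2⟩
    rcases hp2.lt_or_eq with h | h
    · exact Or.inl ⟨p, hp, hp1, by simp at *; omega⟩
    · exact Or.inr (by rwa [show (x, y) = p from Prod.ext h hp1.symm])
  have hfs : (x, y) ∈ E → JumpFst E (x, y + 1) → JumpSnd E (x + 1, y) := by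
    rintro h ⟨p, hp, hp1, hp2⟩
    have hne : y ≠ p.2 := by simp at hp2; omega
    obtain ⟨e, he, h4, h5, h6⟩ :=
      (h3 (x, y) h p hp (fun h => hne (congrArg Prod.snd h))).1 hp1.symm
    have := h6 hne
    exact ⟨e, he, by simp at *; omega, by simp at *; omega⟩
  have hsf : (x, y) ∈ E → JumpSnd E (x + 1, y) → JumpFst E (x, y + 1) := by
    rintro h ⟨p, hp, hp1, hp2⟩
    have hne : x ≠ p.1 := by simp at hp2; omega
    obtain ⟨e, he, h4, h5, h6⟩ :=
      (h3 (x, y) h p hp (fun h => hne (congrArg Prod.fst h))).2 hp1.symm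
    have := h6 hne
    exact ⟨e, he, by simp at *; omega, by simp at *; omega⟩
  have hmf : (x, y) ∈ E → JumpFst E (x, y) := jumpFst_of_mem
  have hms : (x, y) ∈ E → JumpSnd E (x, y) := jumpSnd_of_mem
  have hm := mem_of_jumps h1 (a := (x, y))
  unfold gapFst gapSnd
  clear h1 h3
  split_ifs <;> grind

/-- `ρ` counts the non-jumps of `E` on lattice paths going to infinity; `c` bounds the
conductor of `E`. -/
structure IsColength (E : Set Z2) (c : Z2) (ρ : Z2 → ℕ) : Prop where
  fst : ∀ x y, ρ (x, y) = ρ (x + 1, y) + gapFst E (x, y)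
  snd : ∀ x y, ρ (x, y) = ρ (x, y + 1) + gapSnd E (x, y)
  zero : ∀ a, c ≤ a → ρ a = 0

theorem gapFst_eq_zero {E : Set Z2} {c : Z2} (hc : ∀ y, c ≤ y → y ∈ E) {x : ℤ} (hx : c.1 ≤ x)
    (y : ℤ) : gapFst E (x, y) = 0 :=
  if_pos ⟨(x, max y c.2), hc _ ⟨hx, le_max_right _ _⟩, rfl, le_max_left _ _⟩

theorem gapSnd_eq_zero {E : Set Z2} {c : Z2} (hc : ∀ y, c ≤ y → y ∈ E) (x : ℤ) {y : ℤ}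
    (hy : c.2 ≤ y) : gapSnd E (x, y) = 0 :=
  if_pos ⟨(max x c.1, y), hc _ ⟨le_max_right _ _, hy⟩, rfl, le_max_left _ _⟩

theorem gapSnd_eq_of_conductor_le {E : Set Z2} (h1 : MinClosed E) (h3 : G3P E) {c : Z2}
    (hc : ∀ y, c ≤ y → y ∈ E) (n : ℕ) (y : ℤ) :
    gapSnd E (c.1 + n, y) = gapSnd E (c.1, y) := by
  induction n with
  | zero => simp
  | succ n ih =>
    have h := gap_square h1 h3 (c.1 + n) y
    rw [gapFst_eq_zero hc (by omega), gapFst_eq_zero hc (by omega)] at h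
    push_cast
    rw [← add_assoc]
    omega

theorem sum_gapFst_add_gapSnd {E : Set Z2} (h1 : MinClosed E) (h3 : G3P E) (x y : ℤ) (n : ℕ) :
    ∑ i ∈ Finset.range n, gapFst E (x - 1 - i, y) + gapSnd E (x, y) =
      ∑ i ∈ Finset.range n, gapFst E (x - 1 - i, y + 1) + gapSnd E (x - n, y) := by
  induction n with
  | zero => simp
  | succ n ih =>
    have h := gap_square h1 h3 (x - 1 - n) y
    rw [show x - 1 - (n : ℤ) + 1 = x - n by ring] at h
    rw [Finset.sum_range_succ, Finset.sum_range_succ]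
    push_cast
    rw [show x - ((n : ℤ) + 1) = x - 1 - n by ring]
    omega

theorem exists_isColength {E : Set Z2} (h1 : MinClosed E) (h3 : G3P E) {c : Z2}
    (hc : ∀ y, c ≤ y → y ∈ E) : ∃ ρ, IsColength E c ρ := by
  refine ⟨fun a => ∑ i ∈ Finset.range (c.1 - a.1).toNat, gapFst E (c.1 - 1 - i, a.2) +
    ∑ i ∈ Finset.range (c.2 - a.2).toNat, gapSnd E (c.1, c.2 - 1 - i), ?_, ?_, ?_⟩
  · intro x y
    dsimp only
    rcases le_or_gt c.1 x with h | h
    · rw [gapFst_eq_zero hc h, Int.toNat_eq_zero.2 (by omega : c.1 - x ≤ 0),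
        Int.toNat_eq_zero.2 (by omega : c.1 - (x + 1) ≤ 0), add_zero]
    · rw [show (c.1 - x).toNat = (c.1 - (x + 1)).toNat + 1 by omega, Finset.sum_range_succ,
        show c.1 - 1 - (((c.1 - (x + 1)).toNat : ℕ) : ℤ) = x by omega]
      omega
  · intro x y
    dsimp only
    have key := sum_gapFst_add_gapSnd h1 h3 c.1 y (c.1 - x).toNat
    have hx : gapSnd E (c.1 - (c.1 - x).toNat, y) = gapSnd E (x, y) := by
      rcases le_or_gt c.1 x with h | h
      · rw [Int.toNat_eq_zero.2 (by omega : c.1 - x ≤ 0)]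
        have := gapSnd_eq_of_conductor_le h1 h3 hc (x - c.1).toNat y
        rw [show c.1 + ((x - c.1).toNat : ℤ) = x by omega] at this
        simp [this]
      · rw [show c.1 - ((c.1 - x).toNat : ℤ) = x by omega]
    rw [hx] at key
    rcases le_or_gt c.2 y with h | h
    · rw [gapSnd_eq_zero hc _ h, gapSnd_eq_zero hc _ h] at key
      rw [gapSnd_eq_zero hc _ h, Int.toNat_eq_zero.2 (by omega : c.2 - y ≤ 0),
        Int.toNat_eq_zero.2 (by omega : c.2 - (y + 1) ≤ 0)]
      omega
    · rw [show (c.2 - y).toNat = (c.2 - (y + 1)).toNat + 1 by omega, Finset.sum_range_succ,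
        show c.2 - 1 - (((c.2 - (y + 1)).toNat : ℕ) : ℤ) = y by omega]
      omega
  · intro a ha
    have := ha.1
    have := ha.2
    rw [Int.toNat_eq_zero.2 (by omega : c.1 - a.1 ≤ 0),
      Int.toNat_eq_zero.2 (by omega : c.2 - a.2 ≤ 0)]
    simp

namespace IsColength

variable {E : Set Z2} {c : Z2} {ρ : Z2 → ℕ}

theorem antitone (hρ : IsColength E c ρ) : Antitone ρ := by
  have hf : ∀ y, Antitone fun x => ρ (x, y) := fun y =>
    antitone_int_of_succ_le fun x => by have := hρ.fst x y; omega
  have hs : ∀ x, Antitone fun y => ρ (x, y) := fun x =>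
    antitone_int_of_succ_le fun y => by have := hρ.snd x y; omega
  intro a b h
  exact (hs b.1 h.2).trans (hf a.2 h.1)

/-- If no step inside the box between `a` and `b` is a jump, then `ρ` drops at every step. -/
theorem eq_add_of_no_jump (hρ : IsColength E c ρ) (b : Z2) (n : ℕ) : ∀ a : Z2, a ≤ b →
    b.1 + b.2 - a.1 - a.2 = n →
    (∀ p, a ≤ p → p.1 < b.1 → p.2 ≤ b.2 → ¬ JumpFst E p) →
    (∀ p, a ≤ p → p.1 ≤ b.1 → p.2 < b.2 → ¬ JumpSnd E p) → ρ a = ρ b + n := by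
  induction n with
  | zero =>
    rintro ⟨x, y⟩ ⟨hx, hy⟩ hn - -
    rw [show b = (x, y) from Prod.ext (by simp at *; omega) (by simp at *; omega)]
    rfl
  | succ n ih =>
    rintro ⟨x, y⟩ ⟨hx, hy⟩ hn hf hs
    simp only at hx hy hn
    rcases hx.lt_or_eq with h | h
    · have e := hρ.fst x y
      have e' : gapFst E (x, y) = 1 := if_neg (hf _ le_rfl h hy)
      have hle : ((x, y) : Z2) ≤ (x + 1, y) := ⟨by simp, le_rfl⟩
      have := ih (x + 1, y) ⟨by simpa using h, hy⟩ (by simp; omega)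
        (fun p hp => hf p (hle.trans hp)) (fun p hp => hs p (hle.trans hp))
      omega
    · have h' : y < b.2 := by omega
      have e := hρ.snd x y
      have e' : gapSnd E (x, y) = 1 := if_neg (hs _ le_rfl hx h')
      have hle : ((x, y) : Z2) ≤ (x, y + 1) := ⟨le_rfl, by simp⟩
      have := ih (x, y + 1) ⟨hx, by simpa using h'⟩ (by simp; omega)
        (fun p hp => hf p (hle.trans hp)) (fun p hp => hs p (hle.trans hp))
      omega

/-- A saturated step of `E` contains exactly one jump. -/
theorem add_eq_of_consecutive (hρ : IsColength E c ρ) (h1 : MinClosed E) {a b : Z2} (ha : a ∈ E)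
    (hb : b ∈ E) (hab : a < b) (hcons : ∀ p ∈ E, ¬ (a < p ∧ p < b)) :
    b.1 + b.2 + ρ b = a.1 + a.2 + ρ a + 1 := by
  have hle := hab.le
  have h1' := hle.1
  have h2' := hle.2
  have hcut : ∀ q : Z2, a < q → (∀ p, q ≤ p → p.1 < b.1 → p.2 ≤ b.2 → ¬ JumpFst E p) ∧
      (∀ p, q ≤ p → p.1 ≤ b.1 → p.2 < b.2 → ¬ JumpSnd E p) := by
    intro q haq
    constructor
    · rintro p hp hp1 hp2 ⟨x, hx, hx1, hx2⟩
      refine hcons _ (h1 x hx b hb) ⟨haq.trans_le (hp.trans (le_inf ⟨hx1.ge, hx2⟩ ⟨hp1.le, hp2⟩)),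
        lt_of_le_of_ne inf_le_right fun h => ?_⟩
      have := congrArg Prod.fst h
      simp at this
      omega
    · rintro p hp hp1 hp2 ⟨x, hx, hx2, hx1⟩
      refine hcons _ (h1 x hx b hb) ⟨haq.trans_le (hp.trans (le_inf ⟨hx1, hx2.ge⟩ ⟨hp1, hp2.le⟩)),
        lt_of_le_of_ne inf_le_right fun h => ?_⟩
      have := congrArg Prod.snd h
      simp at this
      omega
  rcases h1'.lt_or_eq with h | h
  · have hq : ((a.1 + 1, a.2) : Z2) ≤ b := ⟨by simpa using h, h2'⟩
    have haq : a < ((a.1 + 1, a.2) : Z2) := Prod.lt_iff.2 (Or.inl ⟨by simp, le_rfl⟩)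
    obtain ⟨hf, hs⟩ := hcut _ haq
    have e := hρ.eq_add_of_no_jump b (b.1 + b.2 - (a.1 + 1) - a.2).toNat _ hq
      (by simp; omega) hf hs
    have e1 := hρ.fst a.1 a.2
    have e2 : gapFst E (a.1, a.2) = 0 := if_pos (jumpFst_of_mem ha)
    simp only [Prod.mk.eta] at e1 e2
    omega
  · have h' : a.2 < b.2 := lt_of_le_of_ne h2' fun h' => hab.ne (Prod.ext h h')
    have hq : ((a.1, a.2 + 1) : Z2) ≤ b := ⟨h1', by simpa using h'⟩
    have haq : a < ((a.1, a.2 + 1) : Z2) := Prod.lt_iff.2 (Or.inr ⟨le_rfl, by simp⟩)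
    obtain ⟨hf, hs⟩ := hcut _ haq
    have e := hρ.eq_add_of_no_jump b (b.1 + b.2 - a.1 - (a.2 + 1)).toNat _ hq
      (by simp; omega) hf hs
    have e1 := hρ.snd a.1 a.2
    have e2 : gapSnd E (a.1, a.2) = 0 := if_pos (jumpSnd_of_mem ha)
    simp only [Prod.mk.eta] at e1 e2
    omega

theorem length_eq_of_isSatChain (hρ : IsColength E c ρ) (h1 : MinClosed E) {n : ℕ} {f : ℕ → Z2}
    (hf : IsSatChain E n f) :
    (n : ℤ) = (f n).1 + (f n).2 + ρ (f n) - ((f 0).1 + (f 0).2 + ρ (f 0)) := by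
  obtain ⟨hm, hlt, hc⟩ := hf
  have : ∀ k ≤ n, (k : ℤ) = (f k).1 + (f k).2 + ρ (f k) - ((f 0).1 + (f 0).2 + ρ (f 0)) := by
    intro k
    induction k with
    | zero => simp
    | succ k ih =>
      intro hk
      have := ih (by omega)
      have := hρ.add_eq_of_consecutive h1 (hm k (by omega)) (hm (k + 1) hk) (hlt k hk) (hc k hk)
      push_cast
      omega
  exact this n le_rfl

end IsColength

theorem exists_isSatChain (E : Set Z2) {b : Z2} (hb : b ∈ E) (m : ℕ) : ∀ a ∈ E, a ≤ b →
    b.1 + b.2 - a.1 - a.2 ≤ m → ∃ n f, IsSatChain E n f ∧ f 0 = a ∧ f n = b := by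
  induction m with
  | zero =>
    intro a ha hab hm
    have := hab.1
    have := hab.2
    refine ⟨0, fun _ => a, ⟨fun _ _ => ha, by simp, by simp⟩, rfl, ?_⟩
    exact Prod.ext (by simp at *; omega) (by simp at *; omega)
  | succ m ih =>
    intro a ha hab hm
    rcases hab.eq_or_lt with rfl | hlt
    · exact ⟨0, fun _ => a, ⟨fun _ _ => ha, by simp, by simp⟩, rfl, rfl⟩
    · have hfin : {p ∈ E | a < p ∧ p ≤ b}.Finite :=
        (Set.finite_Icc a b).subset fun p hp => ⟨hp.2.1.le, hp.2.2⟩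
      obtain ⟨q, ⟨hq, haq, hqb⟩, hmin⟩ := hfin.exists_minimal ⟨b, hb, hlt, le_rfl⟩
      have hsum : a.1 + a.2 < q.1 + q.2 := by
        rcases Prod.lt_iff.1 haq with h | h <;> omega
      push_cast at hm
      obtain ⟨n, f, ⟨hm1, hm2, hm3⟩, h0, hn⟩ := ih q hq hqb (by omega)
      refine ⟨n + 1, fun i => if i = 0 then a else f (i - 1), ⟨?_, ?_, ?_⟩, by simp, by simpa⟩
      · rintro (_ | i) hi
        · simpa
        · simpa using hm1 i (by omega)
      · rintro (_ | i) hi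
        · simpa [h0]
        · simpa using hm2 i (by omega)
      · rintro (_ | i) hi p hp
        · simp only [if_true, zero_add, one_ne_zero, if_false, Nat.sub_self, h0]
          rintro ⟨hap, hpq⟩
          exact hpq.not_ge (hmin ⟨hp, hap, hpq.le.trans hqb⟩ hpq.le)
        · simpa using hm3 i (by omega) p hp

theorem IsColength.chainDist_eq {E : Set Z2} {c : Z2} {ρ : Z2 → ℕ} (hρ : IsColength E c ρ)
    (h1 : MinClosed E) {a b : Z2} (ha : a ∈ E) (hb : b ∈ E) (hab : a ≤ b) :
    (chainDist E a b : ℤ) = b.1 + b.2 + ρ b - (a.1 + a.2 + ρ a) := by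
  obtain ⟨n, f, hf, h0, hn⟩ :=
    exists_isSatChain E hb (b.1 + b.2 - a.1 - a.2).toNat a ha hab (by omega)
  have key := hρ.length_eq_of_isSatChain h1 hf
  rw [h0, hn] at key
  have hset : {k : ℕ | ∃ f : ℕ → Z2, IsSatChain E k f ∧ f 0 = a ∧ f k = b} = {n} := by
    ext k
    constructor
    · rintro ⟨g, hg, hg0, hgn⟩
      have := hρ.length_eq_of_isSatChain h1 hg
      rw [hg0, hgn] at this
      exact Nat.cast_injective (R := ℤ) (this.trans key.symm)
    · rintro rfl
      exact ⟨f, hf, h0, hn⟩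
  rw [chainDist, hset, csSup_singleton, key]

theorem minEl_eq_zero {E : Set Z2} (h : E ⊆ orth) (h0 : (0 : Z2) ∈ E) : minEl E = 0 := by
  have hf : IsLeast (Prod.fst '' E) 0 :=
    ⟨⟨0, h0, rfl⟩, by rintro _ ⟨p, hp, rfl⟩; exact (h hp).1⟩
  have hs : IsLeast (Prod.snd '' E) 0 :=
    ⟨⟨0, h0, rfl⟩, by rintro _ ⟨p, hp, rfl⟩; exact (h hp).2⟩
  exact Prod.ext hf.csInf_eq hs.csInf_eq

theorem minClosed_orth : MinClosed orth := fun _ ha _ hb => ⟨le_min ha.1 hb.1, le_min ha.2 hb.2⟩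

theorem g3P_orth : G3P orth := by
  intro a ha b hb _
  refine ⟨fun _ => ⟨(a.1 + 1, min a.2 b.2), ⟨?_, le_min ha.2 hb.2⟩, by simp, le_rfl, fun _ => rfl⟩,
    fun _ => ⟨(min a.1 b.1, a.2 + 1), ⟨le_min ha.1 hb.1, ?_⟩, by simp, le_rfl, fun _ => rfl⟩⟩
  · have := ha.1; dsimp only; omega
  · have := ha.2; dsimp only; omega

theorem IsColength.genus_eq {T : Set Z2} (hT : IsGood T) {c : Z2} (hc : ∀ y, c ≤ y → y ∈ T)
    {ρ : Z2 → ℕ} (hρ : IsColength T c ρ) : genus T = ρ 0 := by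
  obtain ⟨hTo, h0, -, h1, -, -⟩ := hT
  obtain ⟨σ, hσ⟩ := exists_isColength minClosed_orth g3P_orth (c := 0) fun y hy => ⟨hy.1, hy.2⟩
  have ho : (0 : Z2) ∈ orth := ⟨le_rfl, le_rfl⟩
  have key : ∀ α ∈ T, c ≤ α →
      (chainDist orth (minEl orth) α : ℤ) - (chainDist T (minEl T) α : ℤ) = ρ 0 := by
    intro α hα hcα
    have hα0 : 0 ≤ α := ⟨(hTo hα).1, (hTo hα).2⟩
    rw [minEl_eq_zero subset_rfl ho, minEl_eq_zero hTo h0,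
      hσ.chainDist_eq minClosed_orth ho (hTo hα) hα0, hρ.chainDist_eq h1 h0 hα hα0,
      hσ.zero _ hα0, hσ.zero _ le_rfl, hρ.zero _ hcα]
    simp
  have hset : {z : ℤ | ∃ β : Z2, ∀ α ∈ T, β ≤ α →
      (chainDist orth (minEl orth) α : ℤ) - (chainDist T (minEl T) α : ℤ) = z} = {(ρ 0 : ℤ)} := by
    ext z
    constructor
    · rintro ⟨β, hβ⟩
      exact (hβ (β ⊔ c) (hc _ le_sup_right) le_sup_left).symm.trans
        (key _ (hc _ le_sup_right) le_sup_right)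
    · rintro rfl
      exact ⟨c, key⟩
  rw [genus, dist2, hset, csSup_singleton]

namespace IsColength

variable {T : Set Z2} {c : Z2} {ρ : Z2 → ℕ}

/-- Every point at which `ρ` is positive lies below a gap with the same value of `ρ`. -/
theorem exists_notMem_eq (hρ : IsColength T c ρ) (n : ℕ) : ∀ a : Z2, ρ a ≠ 0 →
    (c.1 - a.1).toNat + (c.2 - a.2).toNat ≤ n → ∃ b, a ≤ b ∧ b ∉ T ∧ ρ b = ρ a := by
  induction n with
  | zero =>
    intro a ha hn
    exact absurd (hρ.zero a ⟨by omega, by omega⟩) ha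
  | succ n ih =>
    intro a ha hn
    by_cases haT : a ∈ T
    · have e1 := hρ.fst a.1 a.2
      have e2 : gapFst T (a.1, a.2) = 0 := if_pos (jumpFst_of_mem haT)
      have e3 := hρ.snd a.1 a.2
      have e4 : gapSnd T (a.1, a.2) = 0 := if_pos (jumpSnd_of_mem haT)
      simp only [Prod.mk.eta] at e1 e2 e3 e4
      by_cases h : a.1 < c.1
      · obtain ⟨b, hb, hbT, hbρ⟩ := ih (a.1 + 1, a.2) (by omega) (by simp only; omega)
        exact ⟨b, le_trans (b := (a.1 + 1, a.2)) ⟨by simp, le_rfl⟩ hb, hbT, by omega⟩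
      · by_cases h' : a.2 < c.2
        · obtain ⟨b, hb, hbT, hbρ⟩ := ih (a.1, a.2 + 1) (by omega) (by simp only; omega)
          exact ⟨b, le_trans (b := (a.1, a.2 + 1)) ⟨le_rfl, by simp⟩ hb, hbT, by omega⟩
        · exact absurd (hρ.zero a ⟨by omega, by omega⟩) ha
    · exact ⟨a, le_rfl, haT, rfl⟩

/-- At a gap, one of the two unit steps is not a jump. -/
theorem succ_le_of_notMem (hρ : IsColength T c ρ) (h1 : MinClosed T) {a : Z2} (ha : a ∉ T) :
    ρ (a.1 + 1, a.2) + 1 ≤ ρ a ∨ ρ (a.1, a.2 + 1) + 1 ≤ ρ a := by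
  have e1 := hρ.fst a.1 a.2
  have e3 := hρ.snd a.1 a.2
  simp only [Prod.mk.eta] at e1 e3
  by_cases hf : JumpFst T a
  · have e4 : gapSnd T a = 1 := if_neg fun hs => ha (mem_of_jumps h1 hf hs)
    omega
  · have e2 : gapFst T a = 1 := if_neg hf
    omega

theorem lt_of_llt (hρ : IsColength T c ρ) (h1 : MinClosed T) {a b : Z2} (ha : a ∉ T)
    (hab : llt a b) : ρ b < ρ a := by
  obtain ⟨hf, hs⟩ := hab
  have l1 : ρ b ≤ ρ (a.1 + 1, a.2) := hρ.antitone ⟨by simp only; omega, by simp only; omega⟩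
  have l2 : ρ b ≤ ρ (a.1, a.2 + 1) := hρ.antitone ⟨by simp only; omega, by simp only; omega⟩
  have := hρ.succ_le_of_notMem h1 ha
  omega

theorem Dof_eq (hρ : IsColength T c ρ) (h1 : MinClosed T) (k : ℕ) (hk : k ≠ 0) :
    Dof {a ∈ orth \ T | k ≤ ρ a} = {a ∈ orth \ T | ρ a = k} := by
  have hB : ∀ a ∈ orth \ T, ρ a = k → a ∈ Bof {a ∈ orth \ T | k ≤ ρ a} := by
    intro a ha hak
    refine ⟨⟨ha, hak.ge⟩, fun b hb hab => ?_⟩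
    have := hρ.lt_of_llt h1 ha.2 hab
    have := hb.2
    omega
  ext a
  constructor
  · rintro ⟨haB, haC⟩
    obtain ⟨⟨ha, hka⟩, hmax⟩ := haB
    refine ⟨ha, ?_⟩
    by_contra hne
    have ha1 := ha.1.1
    have ha2 := ha.1.2
    have hm : ρ (a.1 + 1, a.2 + 1) < k := by
      by_contra hm
      obtain ⟨b, hb, hbT, hbρ⟩ := hρ.exists_notMem_eq _ (a.1 + 1, a.2 + 1) (by omega) le_rfl
      have hb1 := hb.1
      have hb2 := hb.2
      simp only at hb1 hb2
      exact hmax b ⟨⟨⟨by omega, by omega⟩, hbT⟩, by omega⟩ ⟨by omega, by omega⟩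
    have e1 := hρ.fst a.1 a.2
    have e2 := hρ.snd (a.1 + 1) a.2
    have e3 := hρ.snd a.1 a.2
    have e4 := hρ.fst a.1 (a.2 + 1)
    have le_one_fst : ∀ p, gapFst T p ≤ 1 := fun p => by unfold gapFst; split_ifs <;> simp
    have le_one_snd : ∀ p, gapSnd T p ≤ 1 := fun p => by unfold gapSnd; split_ifs <;> simp
    have l1 := le_one_fst (a.1, a.2)
    have l2 := le_one_snd (a.1 + 1, a.2)
    have l3 := le_one_snd (a.1, a.2)
    have l4 := le_one_fst (a.1, a.2 + 1)
    simp only [Prod.mk.eta] at e1 e3 l1 l3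
    have hf : ¬ JumpFst T a := fun h => by
      have : gapFst T a = 0 := if_pos h
      omega
    have hs : ¬ JumpSnd T a := fun h => by
      have : gapSnd T a = 0 := if_pos h
      omega
    refine haC ⟨⟨⟨ha, hka⟩, hmax⟩, (a.1, a.2 + 1), hB _ ⟨⟨ha1, ?_⟩, fun h => ?_⟩ (by omega),
      (a.1 + 1, a.2), hB _ ⟨⟨?_, ha2⟩, fun h => ?_⟩ (by omega), fun h => ?_, fun h => ?_, ?_⟩
    · simp only; omega
    · exact hf ⟨_, h, rfl, by simp⟩
    · simp only; omega
    · exact hs ⟨_, h, rfl, by simp⟩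
    · simpa using congrArg Prod.snd h
    · simpa using congrArg Prod.fst h
    · exact Prod.ext (by simp) (by simp)
  · rintro ⟨ha, hak⟩
    refine ⟨hB a ha hak, ?_⟩
    rintro ⟨-, b, hb, d, hd, hba, hda, hbd⟩
    have hb1 : a ≤ b := hbd.le.trans inf_le_left
    have hd1 : a ≤ d := hbd.le.trans inf_le_right
    have hbk := hb.1.2
    have hdk := hd.1.2
    have hfst := congrArg Prod.fst hbd
    have hsnd := congrArg Prod.snd hbd
    simp at hfst hsnd
    have hb2 := hb1.1
    have hb3 := hb1.2
    have hd2 := hd1.1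
    have hd3 := hd1.2
    have hbn : b.1 ≠ a.1 ∨ b.2 ≠ a.2 := by
      by_contra! h
      exact hba (Prod.ext h.1 h.2)
    have hdn : d.1 ≠ a.1 ∨ d.2 ≠ a.2 := by
      by_contra! h
      exact hda (Prod.ext h.1 h.2)
    have hle : k ≤ ρ (a.1 + 1, a.2) ∧ k ≤ ρ (a.1, a.2 + 1) := by
      rcases lt_or_ge a.1 b.1 with h | h
      · exact ⟨hbk.trans (hρ.antitone ⟨by simp only; omega, hb3⟩),
          hdk.trans (hρ.antitone ⟨hd2, by simp only; omega⟩)⟩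
      · exact ⟨hdk.trans (hρ.antitone ⟨by simp only; omega, hd3⟩),
          hbk.trans (hρ.antitone ⟨hb2, by simp only; omega⟩)⟩
    have := hρ.succ_le_of_notMem h1 ha.2
    omega

theorem pos_of_notMem (hρ : IsColength T c ρ) (h1 : MinClosed T) {a : Z2} (ha : a ∉ T) :
    0 < ρ a := by
  have := hρ.succ_le_of_notMem h1 ha
  omega

theorem NLrem_eq (hρ : IsColength T c ρ) (h1 : MinClosed T) (k : ℕ) :
    NLrem (orth \ T) k = {a ∈ orth \ T | ρ a ≤ k} := by
  induction k with
  | zero =>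
    ext a
    simp only [NLrem, Set.mem_empty_iff_false, Set.mem_ofPred_eq, false_iff]
    rintro ⟨ha, h⟩
    have := hρ.pos_of_notMem h1 ha.2
    omega
  | succ k ih =>
    have hrem : (orth \ T) \ {a ∈ orth \ T | ρ a ≤ k} = {a ∈ orth \ T | k + 1 ≤ ρ a} := by
      ext a
      constructor
      · rintro ⟨ha, h⟩
        exact ⟨ha, by by_contra h'; exact h ⟨ha, by omega⟩⟩
      · rintro ⟨ha, h⟩
        exact ⟨ha, fun h' => by have := h'.2; omega⟩
    rw [NLrem, ih, hrem, hρ.Dof_eq h1 (k + 1) (by omega)]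
    ext a
    simp only [Set.mem_union, Set.mem_ofPred_eq, ← and_or_left]
    exact and_congr_right fun _ => by omega

theorem NL_eq (hρ : IsColength T c ρ) (h1 : MinClosed T) : NL (orth \ T) = ρ 0 := by
  refine IsLeast.csInf_eq ⟨?_, fun N hN => ?_⟩
  · rw [Set.mem_ofPred_eq, hρ.NLrem_eq h1]
    exact fun a ha => ⟨ha, hρ.antitone ⟨ha.1.1, ha.1.2⟩⟩
  · rcases eq_or_ne (ρ 0) 0 with h | h
    · omega
    · obtain ⟨b, hb, hbT, hbρ⟩ := hρ.exists_notMem_eq _ 0 h le_rfl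
      have hmem := hN ⟨⟨hb.1, hb.2⟩, hbT⟩
      rw [hρ.NLrem_eq h1] at hmem
      exact hbρ.symm.le.trans hmem.2

end IsColength

/-- For every local good semigroup `T ⊆ ℕ²`,
`g(T) = NL(ℕ²∖T)`. -/
theorem genus_eq_NL (T : Set Z2) (hT : IsGood T) (hl : IsLocal T) :
    genus T = (NL (orth \ T) : ℤ) := by
  obtain ⟨c, hc⟩ := hT.2.2.2.2.1
  obtain ⟨ρ, hρ⟩ := exists_isColength hT.2.2.2.1 hT.2.2.2.2.2 hc
  rw [hρ.genus_eq hT hc, hρ.NL_eq hT.2.2.2.1]
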